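/- Let τ be a critical or subcritical Galton–Watson tree with offspring distribution p. Then, as n → ∞, τ conditioned on {H(τ) = n} converges locally in distribution to the immortal tree τ*: for every h ∈ ℕ and every tree t of height at most h, lim_{n→∞} P[r_h(τ) = t | H(τ) = n] = P[r_h(τ*) = t]. (Here P[H(τ) = n] > 0 for every n ∈ ℕ.) -/

import Mathlib

open MeasureTheory Filter Set ProbabilityTheory
open scoped ENNReal Topology

namespace GWLocal

/-- Nodes of trees: finite sequences of positive integers. -/
abbrev Node : Type := List ℕ+

/-- A (rooted planar) tree, as a subset of the set `U` of finite sequences of positive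
integers: it contains the root `[]`, is closed under taking prefixes, and the children of
any node `u` form an initial segment `u1, …, uk` for some `k ∈ ℤ₊` (the out-degree of `u`). -/
def IsTree (t : Set Node) : Prop :=
  (([] : Node) ∈ t) ∧
  (∀ u ∈ t, ∀ v : Node, v <+: u → v ∈ t) ∧
  (∀ u ∈ t, ∃ k : ℕ, ∀ i : ℕ+, (u ++ [i]) ∈ t ↔ (i : ℕ) ≤ k)

/-- The out-degree `k_u(t)` of the node `u` in the tree `t`. -/
noncomputable def deg (t : Set Node) (u : Node) : ℕ := {i : ℕ+ | (u ++ [i]) ∈ t}.ncard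

/-- `restrict h t = r_h(t)`, the tree `t` restricted below height `h`. -/
def restrict (h : ℕ) (t : Set Node) : Set Node := {u ∈ t | u.length ≤ h}

/-- `Y h t = Y_h(t)`, the number of nodes of `t` at height `h`. -/
noncomputable def Y (h : ℕ) (t : Set Node) : ℕ := {u ∈ t | u.length = h}.ncard

/-- The height `H(t) = sup{|u| : u ∈ t}` of a tree. -/
noncomputable def height (t : Set Node) : ℕ∞ := ⨆ u ∈ t, (u.length : ℕ∞)

/-- The width `W(t) = sup_{h ∈ ℤ₊} Y_h(t)` of a tree. -/
noncomputable def width (t : Set Node) : ℕ∞ := ⨆ h : ℕ, (Y h t : ℕ∞)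

/-- The subtree of `t` above the node `u`, re-rooted at `u`. -/
def subtreeAt (t : Set Node) (u : Node) : Set Node := {v | u ++ v ∈ t}

/-- The mean `μ = Σ_k k p_k` of an offspring distribution `p`. -/
noncomputable def mean (p : PMF ℕ) : ℝ≥0∞ := ∑' k : ℕ, (k : ℝ≥0∞) * p k

/-- `∏_{u ∈ t, |u| < h} p_{k_u(t)}`: the probability that a GW tree with offspring
distribution `p`, restricted below height `h`, equals `t`. -/
noncomputable def cylProb (p : PMF ℕ) (h : ℕ) (t : Set Node) : ℝ≥0∞ :=
  ∏ᶠ u ∈ {u ∈ t | u.length < h}, p (deg t u)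

/-- `μ^{-b} Y_b(t) ∏_{u ∈ t, |u| < b} p_{k_u(t)}`: the probability that Kesten's immortal
tree `τ*` associated with `p`, restricted below height `b`, equals `t`. -/
noncomputable def kesten (p : PMF ℕ) (b : ℕ) (t : Set Node) : ℝ≥0∞ :=
  ((mean p)⁻¹) ^ b * (Y b t : ℝ≥0∞) * cylProb p b t

/-- The σ-algebra on the space of trees generated by the events `{t : r_h(t) = s}`
(the Borel σ-algebra of the local ultrametric on trees). -/
def treeσ : MeasurableSpace (Set Node) :=
  MeasurableSpace.generateFrom
    {S : Set (Set Node) | ∃ (h : ℕ) (s : Set Node), S = {t | restrict h t = s}}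

/-- `τ` is a Galton–Watson tree with offspring distribution `p` under `P`:
it takes values in trees, is measurable, and for every `h ∈ ℕ = {1,2,…}` and every tree `t`
of height at most `h`, `P[r_h(τ) = t] = ∏_{u ∈ t, |u| < h} p_{k_u(t)}`. -/
def IsGW {Ω : Type*} [MeasurableSpace Ω] (P : Measure Ω) (p : PMF ℕ)
    (τ : Ω → Set Node) : Prop :=
  (∀ ω, IsTree (τ ω)) ∧ (@Measurable Ω (Set Node) _ treeσ τ) ∧
  (∀ h : ℕ, 1 ≤ h → ∀ t : Set Node, IsTree t → height t ≤ (h : ℕ∞) →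
    P {ω | restrict h (τ ω) = t} = cylProb p h t)

/-! ### The generating function and its iterates -/

/-- The generating function of the offspring distribution `p`. -/
noncomputable def genFun (p : PMF ℕ) (x : ℝ≥0∞) : ℝ≥0∞ := ∑' k : ℕ, p k * x ^ k

/-- The divided difference `(y ^ k - x ^ k) / (y - x)`, in the form `Σ_{i < k} y^i x^{k-1-i}`. -/
noncomputable def powSlope (k : ℕ) (x y : ℝ≥0∞) : ℝ≥0∞ :=
  ∑ i ∈ Finset.range k, y ^ i * x ^ (k - 1 - i)

/-- The divided difference of the generating function of `p`. -/
noncomputable def genSlope (p : PMF ℕ) (x y : ℝ≥0∞) : ℝ≥0∞ := ∑' k : ℕ, p k * powSlope k x y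

/-- The `n`-th iterate of the generating function at `0`: the probability that a GW tree
has no node at height `n`. -/
noncomputable def extProb (p : PMF ℕ) : ℕ → ℝ≥0∞
  | 0 => 0
  | n + 1 => genFun p (extProb p n)

lemma powSlope_mul_add (k : ℕ) {x y : ℝ≥0∞} (h : x ≤ y) :
    powSlope k x y * (y - x) + x ^ k = y ^ k := by
  have := geom_sum₂_mul_add (y - x) x k
  rwa [tsub_add_cancel_of_le h] at this

lemma genSlope_mul_add (p : PMF ℕ) {x y : ℝ≥0∞} (h : x ≤ y) :
    genSlope p x y * (y - x) + genFun p x = genFun p y := by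
  simp only [genSlope, genFun, ← ENNReal.tsum_mul_right, ← ENNReal.tsum_add]
  exact tsum_congr fun k => by rw [mul_assoc, ← mul_add, powSlope_mul_add k h]

lemma genFun_mono (p : PMF ℕ) : Monotone (genFun p) := fun x y h =>
  ENNReal.tsum_le_tsum fun k => by gcongr

lemma genFun_one (p : PMF ℕ) : genFun p 1 = 1 := by simp [genFun, p.tsum_coe]

lemma genFun_zero (p : PMF ℕ) : genFun p 0 = p 0 := by
  rw [genFun, tsum_eq_single 0 fun k hk => by simp [hk]]
  simp

lemma powSlope_mono (k : ℕ) {x x' y y' : ℝ≥0∞} (hx : x ≤ x') (hy : y ≤ y') :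
    powSlope k x y ≤ powSlope k x' y' :=
  Finset.sum_le_sum fun i _ => by gcongr

lemma powSlope_one_one (k : ℕ) : powSlope k 1 1 = k := by simp [powSlope]

lemma genSlope_mono (p : PMF ℕ) {x x' y y' : ℝ≥0∞} (hx : x ≤ x') (hy : y ≤ y') :
    genSlope p x y ≤ genSlope p x' y' :=
  ENNReal.tsum_le_tsum fun k => mul_le_mul_right (powSlope_mono k hx hy) _

lemma genSlope_one_one (p : PMF ℕ) : genSlope p 1 1 = mean p := by
  simp [genSlope, mean, powSlope_one_one, mul_comm]

lemma genSlope_le_mean (p : PMF ℕ) {x y : ℝ≥0∞} (hx : x ≤ 1) (hy : y ≤ 1) :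
    genSlope p x y ≤ mean p :=
  (genSlope_mono p hx hy).trans_eq (genSlope_one_one p)

lemma powSlope_one_lt {k : ℕ} (hk : 2 ≤ k) {x : ℝ≥0∞} (hx : x < 1) : powSlope k x 1 < k := by
  obtain ⟨j, rfl⟩ : ∃ j, k = j + 1 := ⟨k - 1, by omega⟩
  have hj : j ≠ 0 := by omega
  rw [powSlope, Finset.sum_range_succ']
  have h1 : ∑ i ∈ Finset.range j, (1 : ℝ≥0∞) ^ (i + 1) * x ^ (j + 1 - 1 - (i + 1)) ≤ j := by
    refine (Finset.sum_le_sum (g := fun _ => 1) fun i _ => ?_).trans (by simp)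
    simpa using pow_le_one₀ (zero_le) hx.le
  have h2 : (1 : ℝ≥0∞) ^ 0 * x ^ (j + 1 - 1 - 0) < 1 := by
    simpa using pow_lt_one₀ (zero_le) hx hj
  push_cast
  exact ENNReal.add_lt_add_of_le_of_lt (ne_top_of_le_ne_top (ENNReal.natCast_ne_top j) h1) h1 h2

lemma genSlope_one_lt_one (p : PMF ℕ) (hp1 : p 1 < 1) (hμle : mean p ≤ 1) {x : ℝ≥0∞}
    (hx : x < 1) : genSlope p x 1 < 1 := by
  by_cases h : ∃ k, 2 ≤ k ∧ p k ≠ 0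
  · obtain ⟨k, hk, hpk⟩ := h
    refine lt_of_lt_of_le ?_ hμle
    rw [← genSlope_one_one]
    refine ENNReal.tsum_lt_tsum (i := k) ?_
      (fun j => mul_le_mul_right (powSlope_mono j hx.le le_rfl) _) ?_
    · exact ne_top_of_le_ne_top ENNReal.one_ne_top ((genSlope_le_mean p hx.le le_rfl).trans hμle)
    · rw [powSlope_one_one]
      exact ENNReal.mul_lt_mul_right hpk (p.apply_ne_top k) (powSlope_one_lt hk hx)
  · push Not at h
    rw [genSlope, tsum_eq_single 1]
    · simpa [powSlope] using hp1
    · intro k hk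
      rcases Nat.lt_or_ge k 2 with h2 | h2
      · obtain rfl : k = 0 := by omega
        simp [powSlope]
      · simp [h k h2]

lemma extProb_le_one (p : PMF ℕ) (n : ℕ) : extProb p n ≤ 1 := by
  induction n with
  | zero => exact zero_le
  | succ n ih => exact (genFun_mono p ih).trans_eq (genFun_one p)

lemma extProb_ne_top (p : PMF ℕ) (n : ℕ) : extProb p n ≠ ∞ :=
  ne_top_of_le_ne_top ENNReal.one_ne_top (extProb_le_one p n)

lemma extProb_le_succ (p : PMF ℕ) (n : ℕ) : extProb p n ≤ extProb p (n + 1) := by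
  induction n with
  | zero => exact zero_le
  | succ n ih => exact genFun_mono p ih

lemma extProb_mono (p : PMF ℕ) : Monotone (extProb p) :=
  monotone_nat_of_le_succ (extProb_le_succ p)

lemma apply_zero_pos (p : PMF ℕ) (hp1 : p 1 < 1) (hμle : mean p ≤ 1) : 0 < p 0 := by
  have h := genSlope_mul_add p (zero_le : (0 : ℝ≥0∞) ≤ 1)
  rw [genFun_one, genFun_zero, tsub_zero, mul_one] at h
  refine pos_iff_ne_zero.2 fun h0 => ?_
  rw [h0, add_zero] at h
  exact (genSlope_one_lt_one p hp1 hμle zero_lt_one).ne h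

lemma tendsto_extProb (p : PMF ℕ) (hp1 : p 1 < 1) (hμle : mean p ≤ 1) :
    Tendsto (extProb p) atTop (𝓝 1) := by
  have hL : ⨆ n, extProb p n = 1 := by
    refine le_antisymm (iSup_le (extProb_le_one p)) ?_
    by_contra! hlt
    set L := ⨆ n, extProb p n
    set c := genSlope p L 1
    have hc : c < 1 := genSlope_one_lt_one p hp1 hμle hlt
    have hbound : ∀ n, 1 - extProb p n ≤ c ^ n := by
      intro n
      induction n with
      | zero => simp
      | succ n ih =>
        have h := genSlope_mul_add p (extProb_le_one p n)
        rw [genFun_one] at h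
        calc 1 - extProb p (n + 1) = genSlope p (extProb p n) 1 * (1 - extProb p n) :=
              (ENNReal.eq_sub_of_add_eq (extProb_ne_top p (n + 1)) h).symm
          _ ≤ c * c ^ n := mul_le_mul' (genSlope_mono p (le_iSup _ n) le_rfl) ih
          _ = c ^ (n + 1) := (pow_succ' c n).symm
    have hle : 1 - L ≤ 0 := ge_of_tendsto' (ENNReal.tendsto_pow_atTop_nhds_zero_of_lt_one hc)
      fun n => (tsub_le_tsub_left (le_iSup _ n) 1).trans (hbound n)
    exact (tsub_pos_of_lt hlt).not_ge hle
  exact hL ▸ tendsto_atTop_iSup (extProb_mono p)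

lemma tendsto_powSlope (k : ℕ) {x y : ℕ → ℝ≥0∞} (hx : Tendsto x atTop (𝓝 1))
    (hy : Tendsto y atTop (𝓝 1)) : Tendsto (fun n => powSlope k (x n) (y n)) atTop (𝓝 k) := by
  rw [← powSlope_one_one k]
  refine tendsto_finsetSum _ fun i _ => ?_
  exact ENNReal.Tendsto.mul (ENNReal.Tendsto.pow hy) (by simp) (ENNReal.Tendsto.pow hx) (by simp)

lemma tendsto_genSlope (p : PMF ℕ) {x y : ℕ → ℝ≥0∞} (hx : Tendsto x atTop (𝓝 1))
    (hy : Tendsto y atTop (𝓝 1)) (hx1 : ∀ n, x n ≤ 1) (hy1 : ∀ n, y n ≤ 1) :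
    Tendsto (fun n => genSlope p (x n) (y n)) atTop (𝓝 (mean p)) := by
  refine tendsto_order.2 ⟨fun b hb => ?_, fun b hb => Eventually.of_forall fun n =>
    (genSlope_le_mean p (hx1 n) (hy1 n)).trans_lt hb⟩
  rw [mean, ENNReal.tsum_eq_iSup_sum, lt_iSup_iff] at hb
  obtain ⟨s, hs⟩ := hb
  have hlim : Tendsto (fun n => ∑ k ∈ s, p k * powSlope k (x n) (y n)) atTop
      (𝓝 (∑ k ∈ s, (k : ℝ≥0∞) * p k)) := by
    refine tendsto_finsetSum _ fun k _ => ?_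
    rw [mul_comm]
    exact ENNReal.Tendsto.const_mul (tendsto_powSlope k hx hy) (Or.inr (p.apply_ne_top k))
  filter_upwards [hlim.eventually_const_lt hs] with n hn
  exact hn.trans_le (ENNReal.sum_le_tsum s)

lemma genSlope_pos (p : PMF ℕ) (hμpos : 0 < mean p) (x : ℝ≥0∞) {y : ℝ≥0∞} (hy : 0 < y) :
    0 < genSlope p x y := by
  obtain ⟨k, hk⟩ : ∃ k : ℕ, (k : ℝ≥0∞) * p k ≠ 0 := by
    by_contra! h
    simp [mean, h] at hμpos
  have hk0 : k ≠ 0 := by rintro rfl; simp at hk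
  have hterm : 0 < p k * powSlope k x y := by
    refine ENNReal.mul_pos (right_ne_zero_of_mul hk) (ne_of_gt ?_)
    refine (ENNReal.pow_pos hy (k - 1)).trans_le ?_
    refine le_trans (by simp) (Finset.single_le_sum (f := fun i => y ^ i * x ^ (k - 1 - i))
      (fun _ _ => zero_le) (Finset.mem_range.2 (Nat.sub_one_lt hk0)))
  exact hterm.trans_le (ENNReal.le_tsum k)

/-- The slope of the generating function between two consecutive iterates at `0`. -/
noncomputable def iterSlope (p : PMF ℕ) (n : ℕ) : ℝ≥0∞ :=
  genSlope p (extProb p n) (extProb p (n + 1))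

lemma extProb_diff_succ (p : PMF ℕ) (n : ℕ) :
    extProb p (n + 2) - extProb p (n + 1) =
      iterSlope p n * (extProb p (n + 1) - extProb p n) := by
  have h := genSlope_mul_add p (extProb_le_succ p n)
  rw [show extProb p (n + 2) = genFun p (extProb p (n + 1)) from rfl, ← h]
  exact ENNReal.add_sub_cancel_right (extProb_ne_top p (n + 1))

lemma extProb_diff_add (p : PMF ℕ) (n h : ℕ) :
    extProb p (n + h + 1) - extProb p (n + h) =
      (∏ j ∈ Finset.range h, iterSlope p (n + j)) * (extProb p (n + 1) - extProb p n) := by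
  induction h with
  | zero => simp
  | succ h ih =>
    rw [show n + (h + 1) + 1 = n + h + 2 by omega, ← add_assoc, extProb_diff_succ, ih,
      Finset.prod_range_succ]
    ring

lemma extProb_diff_pos (p : PMF ℕ) (hp1 : p 1 < 1) (hμpos : 0 < mean p) (hμle : mean p ≤ 1)
    (n : ℕ) : 0 < extProb p (n + 1) - extProb p n := by
  have hone : extProb p 1 = p 0 := genFun_zero p
  have h0 := apply_zero_pos p hp1 hμle
  induction n with
  | zero => rwa [zero_add, hone, show extProb p 0 = 0 from rfl, tsub_zero]
  | succ n ih =>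
    rw [extProb_diff_succ]
    refine ENNReal.mul_pos (genSlope_pos p hμpos _ ?_).ne' ih.ne'
    exact (hone ▸ h0).trans_le (extProb_mono p (by omega))

lemma tendsto_iterSlope (p : PMF ℕ) (hp1 : p 1 < 1) (hμle : mean p ≤ 1) :
    Tendsto (iterSlope p) atTop (𝓝 (mean p)) :=
  have h := tendsto_extProb p hp1 hμle
  tendsto_genSlope p h ((tendsto_add_atTop_iff_nat 1).2 h) (extProb_le_one p)
    fun n => extProb_le_one p (n + 1)

lemma tendsto_extProb_pow_diff_div (p : PMF ℕ) (hp1 : p 1 < 1) (hμpos : 0 < mean p)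
    (hμle : mean p ≤ 1) (h k : ℕ) :
    Tendsto (fun n => (extProb p (n + 1) ^ k - extProb p n ^ k) /
        (extProb p (n + h + 1) - extProb p (n + h)))
      atTop (𝓝 ((mean p)⁻¹ ^ h * k)) := by
  have hq := tendsto_extProb p hp1 hμle
  have hμtop : mean p ≠ ∞ := ne_top_of_le_ne_top ENNReal.one_ne_top hμle
  have heq : ∀ n, (extProb p (n + 1) ^ k - extProb p n ^ k) /
      (extProb p (n + h + 1) - extProb p (n + h)) =
      powSlope k (extProb p n) (extProb p (n + 1)) /
        ∏ j ∈ Finset.range h, iterSlope p (n + j) := by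
    intro n
    rw [extProb_diff_add, ← powSlope_mul_add k (extProb_le_succ p n),
      ENNReal.add_sub_cancel_right (ENNReal.pow_ne_top (extProb_ne_top p n))]
    exact ENNReal.mul_div_mul_right _ _ (extProb_diff_pos p hp1 hμpos hμle n).ne'
      (ENNReal.sub_ne_top (extProb_ne_top p (n + 1)))
  have hprod : Tendsto (fun n => ∏ j ∈ Finset.range h, iterSlope p (n + j)) atTop
      (𝓝 (mean p ^ h)) := by
    have := ENNReal.tendsto_finsetProd_of_ne_top (f := fun j n => iterSlope p (n + j))
      (x := atTop) (a := fun _ => mean p) (Finset.range h)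
      (fun j _ => (tendsto_add_atTop_iff_nat j).2 (tendsto_iterSlope p hp1 hμle))
      (fun _ _ => hμtop)
    simpa using this
  simp only [heq]
  have hdiv := ENNReal.Tendsto.div
    (tendsto_powSlope k hq ((tendsto_add_atTop_iff_nat 1).2 hq))
    (Or.inr (pow_ne_zero h hμpos.ne')) hprod (Or.inl (ENNReal.pow_ne_top hμtop))
  rwa [div_eq_mul_inv, ENNReal.inv_pow, mul_comm] at hdiv

/-! ### Levels and one-level extensions of trees -/

/-- The set of nodes of `t` at height `h`. -/
def level (h : ℕ) (t : Set Node) : Set Node := {u ∈ t | u.length = h}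

/-- The tree obtained from `t` by attaching `c u` children to every node `u` of `t` at
height `h`. -/
def extend (h : ℕ) (t : Set Node) (c : level h t → ℕ) : Set Node :=
  t ∪ {v | ∃ (u : level h t) (i : ℕ+), (i : ℕ) ≤ c u ∧ v = u.1 ++ [i]}

lemma height_le_iff {t : Set Node} {h : ℕ} : height t ≤ (h : ℕ∞) ↔ ∀ u ∈ t, u.length ≤ h := by
  simp [height]

lemma setOf_coe_le_eq_image (k : ℕ) :
    {i : ℕ+ | (i : ℕ) ≤ k} = Nat.succPNat '' (Finset.range k : Set ℕ) := by
  ext i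
  simp only [mem_ofPred_eq, mem_image, Finset.coe_range, mem_Iio]
  constructor
  · intro hi
    exact ⟨i.natPred, by have := i.natPred_add_one; omega, i.succPNat_natPred⟩
  · rintro ⟨j, hj, rfl⟩
    exact hj

lemma finite_setOf_coe_le (k : ℕ) : {i : ℕ+ | (i : ℕ) ≤ k}.Finite := by
  rw [setOf_coe_le_eq_image]
  exact (Finset.finite_toSet _).image _

lemma ncard_setOf_coe_le (k : ℕ) : {i : ℕ+ | (i : ℕ) ≤ k}.ncard = k := by
  rw [setOf_coe_le_eq_image, ncard_image_of_injective _ Nat.succPNat_injective, ncard_coe_finset,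
    Finset.card_range]

lemma deg_eq_of_forall {t : Set Node} {u : Node} {k : ℕ}
    (h : ∀ i : ℕ+, (u ++ [i]) ∈ t ↔ (i : ℕ) ≤ k) : deg t u = k := by
  simp only [deg, h, ncard_setOf_coe_le]

lemma IsTree.append_mem_iff {t : Set Node} (ht : IsTree t) {u : Node} (hu : u ∈ t) (i : ℕ+) :
    (u ++ [i]) ∈ t ↔ (i : ℕ) ≤ deg t u := by
  obtain ⟨k, hk⟩ := ht.2.2 u hu
  rw [deg_eq_of_forall hk, hk]

lemma IsTree.mem_of_append_mem {t : Set Node} (ht : IsTree t) {u v : Node} (h : u ++ v ∈ t) :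
    u ∈ t :=
  ht.2.1 _ h _ (List.prefix_append u v)

lemma exists_append_of_length_succ {v : Node} {h : ℕ} (hv : v.length = h + 1) :
    ∃ (u : Node) (i : ℕ+), u.length = h ∧ v = u ++ [i] := by
  have hne : v ≠ [] := by rintro rfl; simp at hv
  exact ⟨v.dropLast, v.getLast hne, by simp [hv], (List.dropLast_append_getLast hne).symm⟩

lemma level_succ {t : Set Node} (ht : IsTree t) (h : ℕ) :
    level (h + 1) t = ⋃ u : level h t, (fun i : ℕ+ => u.1 ++ [i]) '' {i | (i : ℕ) ≤ deg t u} := by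
  ext v
  simp only [mem_iUnion, mem_image, mem_ofPred_eq, level]
  constructor
  · rintro ⟨hv, hl⟩
    obtain ⟨u, i, hu, rfl⟩ := exists_append_of_length_succ hl
    exact ⟨⟨u, ht.mem_of_append_mem hv, hu⟩, i,
      (ht.append_mem_iff (ht.mem_of_append_mem hv) i).1 hv, rfl⟩
  · rintro ⟨u, i, hi, rfl⟩
    exact ⟨(ht.append_mem_iff u.2.1 i).2 hi, by simp [u.2.2]⟩

lemma finite_level {t : Set Node} (ht : IsTree t) (h : ℕ) : (level h t).Finite := by
  induction h with
  | zero => exact (finite_singleton ([] : Node)).subset fun u hu => List.length_eq_zero_iff.1 hu.2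
  | succ h ih =>
    have := ih.to_subtype
    rw [level_succ ht]
    exact finite_iUnion fun u => (finite_setOf_coe_le _).image _

lemma Y_succ {t : Set Node} (ht : IsTree t) (h : ℕ) [Fintype (level h t)] :
    Y (h + 1) t = ∑ u : level h t, deg t u := by
  change (level (h + 1) t).ncard = _
  rw [level_succ ht, ncard_iUnion_of_finite fun u => (finite_setOf_coe_le _).image _,
    finsum_eq_sum_of_fintype]
  · refine Finset.sum_congr rfl fun u _ => ?_
    rw [ncard_image_of_injective _ fun i j hij => by simpa using hij, ncard_setOf_coe_le]
  · intro u v huv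
    rw [Function.onFun, Set.disjoint_left]
    rintro _ ⟨i, -, rfl⟩ ⟨j, -, hj⟩
    exact huv (Subtype.ext (List.append_inj' hj rfl).1.symm)

lemma finite_length_lt {t : Set Node} (ht : IsTree t) (h : ℕ) :
    {u ∈ t | u.length < h}.Finite := by
  refine ((finite_Iio h).biUnion fun k _ => finite_level ht k).subset fun u hu => ?_
  exact mem_biUnion (mem_Iio.2 hu.2) ⟨hu.1, rfl⟩

lemma cylProb_succ (p : PMF ℕ) {t : Set Node} (ht : IsTree t) (h : ℕ) [Fintype (level h t)] :
    cylProb p (h + 1) t = cylProb p h t * ∏ u : level h t, p (deg t u) := by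
  have hunion : {u ∈ t | u.length < h + 1} = {u ∈ t | u.length < h} ∪ level h t := by
    ext u
    simp only [level, mem_ofPred_eq, mem_union, ← and_or_left, Nat.lt_succ_iff_lt_or_eq]
  have hdisj : Disjoint {u ∈ t | u.length < h} (level h t) :=
    Set.disjoint_left.2 fun u hu hu' => hu.2.ne hu'.2
  rw [cylProb, hunion, finprod_mem_union hdisj (finite_length_lt ht h) (finite_level ht h),
    ← finprod_set_coe_eq_finprod_mem (level h t),
    finprod_eq_prod_of_fintype (fun u : level h t => p (deg t u)), cylProb]

lemma append_mem_extend_iff {h : ℕ} {t : Set Node} {c : level h t → ℕ} {u : Node} {i : ℕ+} :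
    u ++ [i] ∈ extend h t c ↔ u ++ [i] ∈ t ∨ ∃ hu : u ∈ level h t, (i : ℕ) ≤ c ⟨u, hu⟩ := by
  refine or_congr_right ⟨?_, fun ⟨hu, hi⟩ => ⟨⟨u, hu⟩, i, hi, rfl⟩⟩
  rintro ⟨w, j, hj, he⟩
  obtain ⟨rfl, hij⟩ := List.append_inj' he rfl
  obtain rfl : i = j := by simpa using hij
  exact ⟨w.2, hj⟩

lemma append_mem_extend_iff_of_mem_level {h : ℕ} {t : Set Node} (hh : ∀ u ∈ t, u.length ≤ h)
    (c : level h t → ℕ) (u : level h t) (i : ℕ+) :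
    u.1 ++ [i] ∈ extend h t c ↔ (i : ℕ) ≤ c u := by
  rw [append_mem_extend_iff]
  refine ⟨?_, fun hi => Or.inr ⟨u.2, hi⟩⟩
  rintro (hm | ⟨_, hi⟩)
  · have := hh _ hm
    have := u.2.2
    simp at *
    omega
  · exact hi

lemma append_mem_extend_iff_of_length_lt {h : ℕ} {t : Set Node} (c : level h t → ℕ) {u : Node}
    (hu : u.length < h) (i : ℕ+) : u ++ [i] ∈ extend h t c ↔ u ++ [i] ∈ t := by
  rw [append_mem_extend_iff]
  exact or_iff_left fun ⟨hl, _⟩ => hu.ne hl.2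

lemma deg_extend_of_mem_level {h : ℕ} {t : Set Node} (hh : ∀ u ∈ t, u.length ≤ h)
    (c : level h t → ℕ) (u : level h t) : deg (extend h t c) u = c u :=
  deg_eq_of_forall (append_mem_extend_iff_of_mem_level hh c u)

lemma length_le_of_mem_extend {h : ℕ} {t : Set Node} (hh : ∀ u ∈ t, u.length ≤ h)
    (c : level h t → ℕ) : ∀ u ∈ extend h t c, u.length ≤ h + 1 := by
  rintro v (hv | ⟨u, i, -, rfl⟩)
  · exact (hh v hv).trans (Nat.le_succ h)
  · simp [u.2.2]

lemma IsTree.extend {h : ℕ} {t : Set Node} (ht : IsTree t) (hh : ∀ u ∈ t, u.length ≤ h)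
    (c : level h t → ℕ) : IsTree (extend h t c) := by
  refine ⟨Or.inl ht.1, ?_, ?_⟩
  · rintro v (hv | ⟨u, i, hi, rfl⟩) w hw
    · exact Or.inl (ht.2.1 v hv w hw)
    · rcases List.prefix_concat_iff.1 hw with rfl | hw
      · exact Or.inr ⟨u, i, hi, rfl⟩
      · exact Or.inl (ht.2.1 u u.2.1 w hw)
  · rintro v (hv | ⟨u, j, -, rfl⟩)
    · rcases (hh v hv).lt_or_eq with hlt | heq
      · simp only [append_mem_extend_iff_of_length_lt c hlt]
        exact ht.2.2 v hv
      · exact ⟨c ⟨v, hv, heq⟩, append_mem_extend_iff_of_mem_level hh c ⟨v, hv, heq⟩⟩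
    · refine ⟨0, fun i => iff_of_false (fun hm => ?_) (by simp)⟩
      have := length_le_of_mem_extend hh c _ hm
      simp [u.2.2] at this

lemma restrict_extend {h : ℕ} {t : Set Node} (hh : ∀ u ∈ t, u.length ≤ h)
    (c : level h t → ℕ) : restrict h (extend h t c) = t := by
  ext v
  refine ⟨?_, fun hv => ⟨Or.inl hv, hh v hv⟩⟩
  rintro ⟨hv | ⟨u, i, -, rfl⟩, hl⟩
  · exact hv
  · simp [u.2.2] at hl

lemma level_restrict (h : ℕ) (t : Set Node) : level h (restrict h t) = level h t := by
  ext u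
  simp only [level, restrict, mem_ofPred_eq, and_assoc]
  exact and_congr_right fun _ => and_iff_right_of_imp fun h => h.le

lemma level_extend {h : ℕ} {t : Set Node} (hh : ∀ u ∈ t, u.length ≤ h) (c : level h t → ℕ) :
    level h (extend h t c) = level h t := by
  rw [← level_restrict, restrict_extend hh]

lemma extend_injective {h : ℕ} {t : Set Node} (hh : ∀ u ∈ t, u.length ≤ h) :
    Function.Injective (extend h t) := fun c c' hc => by
  ext u
  rw [← deg_extend_of_mem_level hh c, hc, deg_extend_of_mem_level hh c']

lemma cylProb_extend (p : PMF ℕ) {h : ℕ} {t : Set Node} (ht : IsTree t)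
    (hh : ∀ u ∈ t, u.length ≤ h) (c : level h t → ℕ) [Fintype (level h t)] :
    cylProb p (h + 1) (extend h t c) = cylProb p h t * ∏ u, p (c u) := by
  have hl := level_extend hh c
  let e : level h (extend h t c) ≃ level h t := Equiv.setCongr hl
  let : Fintype (level h (extend h t c)) := Fintype.ofEquiv _ e.symm
  rw [cylProb_succ p (ht.extend hh c)]
  congr 1
  · have hs : {u ∈ extend h t c | u.length < h} = {u ∈ t | u.length < h} := by
      ext u
      refine and_congr_left fun hu => ?_
      conv_rhs => rw [← restrict_extend hh c]
      exact (and_iff_left hu.le).symm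
    rw [cylProb, hs, cylProb]
    refine finprod_mem_congr rfl fun u hu => ?_
    simp only [deg, append_mem_extend_iff_of_length_lt c hu.2]
  · exact Fintype.prod_equiv e _ _ fun u => by
      rw [← deg_extend_of_mem_level hh c]; rfl

lemma Y_extend {h : ℕ} {t : Set Node} (ht : IsTree t)
    (hh : ∀ u ∈ t, u.length ≤ h) (c : level h t → ℕ) [Fintype (level h t)] :
    Y (h + 1) (extend h t c) = ∑ u, c u := by
  have hl := level_extend hh c
  let e : level h (extend h t c) ≃ level h t := Equiv.setCongr hl
  let : Fintype (level h (extend h t c)) := Fintype.ofEquiv _ e.symm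
  rw [Y_succ (ht.extend hh c)]
  exact Fintype.sum_equiv e _ _ fun u => by
      rw [← deg_extend_of_mem_level hh c]; rfl

lemma restrict_restrict_succ (h : ℕ) (t : Set Node) :
    restrict h (restrict (h + 1) t) = restrict h t := by
  ext u
  simp only [restrict, mem_ofPred_eq, and_assoc]
  exact and_congr_right fun _ => and_iff_right_of_imp fun h => h.trans (Nat.le_succ _)

lemma exists_restrict_succ_eq_extend {t : Set Node} (ht : IsTree t) (h : ℕ) :
    ∃ c, restrict (h + 1) t = extend h (restrict h t) c := by
  refine ⟨fun u => deg t u, ?_⟩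
  ext v
  constructor
  · rintro ⟨hv, hl⟩
    rcases Nat.le_succ_iff.1 hl with hl | hl
    · exact Or.inl ⟨hv, hl⟩
    · obtain ⟨u, i, hu, rfl⟩ := exists_append_of_length_succ hl
      have hut := ht.mem_of_append_mem hv
      exact Or.inr ⟨⟨u, ⟨hut, hu.le⟩, hu⟩, i, (ht.append_mem_iff hut i).1 hv, rfl⟩
  · rintro (hv | ⟨u, i, hi, rfl⟩)
    · exact ⟨hv.1, hv.2.trans (Nat.le_succ h)⟩
    · exact ⟨(ht.append_mem_iff u.2.1.1 i).2 hi, by simp [u.2.2]⟩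

lemma restrict_zero {t : Set Node} (ht : IsTree t) : restrict 0 t = {[]} := by
  ext u
  simp only [restrict, mem_ofPred_eq, nonpos_iff_eq_zero, List.length_eq_zero_iff,
    mem_singleton_iff, and_iff_right_iff_imp]
  rintro rfl
  exact ht.1

lemma isTree_singleton_nil : IsTree {[]} :=
  ⟨rfl, by rintro _ rfl v hv; exact List.prefix_nil.1 hv, fun u _ => ⟨0, fun i => by simp⟩⟩

/-! ### The law of the height of a GW tree -/

lemma tsum_prod_eq_pow {ι : Type*} [Fintype ι] (f : ℕ → ℝ≥0∞) :
    ∑' c : ι → ℕ, ∏ i, f (c i) = (∑' k, f k) ^ Fintype.card ι := by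
  have hfin : ∀ n, ∑' c : Fin n → ℕ, ∏ i, f (c i) = (∑' k, f k) ^ n := by
    intro n
    induction n with
    | zero => simp
    | succ n ih =>
      rw [← (Fin.consEquiv fun _ : Fin (n + 1) => ℕ).tsum_eq, ENNReal.tsum_prod']
      simp only [Fin.consEquiv_apply, Fin.prod_univ_succ, Fin.cons_zero, Fin.cons_succ,
        ENNReal.tsum_mul_left, ih, ENNReal.tsum_mul_right, pow_succ']
  rw [← hfin, ← (Equiv.arrowCongr (Fintype.equivFin ι).symm (Equiv.refl ℕ)).tsum_eq]
  refine tsum_congr fun c => ?_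
  exact Fintype.prod_equiv (Fintype.equivFin ι) _ _ fun i => rfl

section GW

variable {Ω : Type*}

/-- The event that `τ` restricted below height `h` equals `t`. -/
def restrictEvent (τ : Ω → Set Node) (h : ℕ) (t : Set Node) : Set Ω :=
  {ω | restrict h (τ ω) = t}

/-- The event that all nodes of `τ` have height less than `m`. -/
def heightLT (τ : Ω → Set Node) (m : ℕ) : Set Ω := {ω | ∀ u ∈ τ ω, u.length < m}

lemma pairwise_disjoint_restrictEvent_extend (τ : Ω → Set Node) {h : ℕ} {t : Set Node}
    (hh : ∀ u ∈ t, u.length ≤ h) :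
    Pairwise (Function.onFun Disjoint
      fun c : level h t → ℕ => restrictEvent τ (h + 1) (extend h t c)) := fun c c' hcc => by
  rw [Function.onFun, Set.disjoint_left]
  intro ω hω hω'
  exact hcc (extend_injective hh (Eq.trans (Eq.symm hω) hω'))

lemma restrictEvent_inter_heightLT_eq_empty (τ : Ω → Set Node) {h : ℕ} {t : Set Node}
    (hl : (level h t).Nonempty) : restrictEvent τ h t ∩ heightLT τ h = ∅ := by
  refine eq_empty_of_forall_notMem ?_
  rintro ω ⟨rfl, hω⟩
  obtain ⟨u, hu⟩ := hl
  exact (hω u hu.1.1).ne hu.2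

lemma heightLT_mono (τ : Ω → Set Node) : Monotone (heightLT τ) :=
  fun _ _ hmn _ hω u hu => (hω u hu).trans_le hmn

lemma setOf_height_eq (τ : Ω → Set Node) {n : ℕ} (hn : n ≠ 0) :
    {ω | height (τ ω) = (n : ℕ∞)} = heightLT τ (n + 1) \ heightLT τ n := by
  obtain ⟨m, rfl⟩ := Nat.exists_eq_succ_of_ne_zero hn
  ext ω
  have hlt : ∀ k : ℕ, ω ∈ heightLT τ (k + 1) ↔ height (τ ω) ≤ (k : ℕ∞) := fun k => by
    rw [height_le_iff]
    exact forall₂_congr fun u _ => Nat.lt_succ_iff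
  rw [Set.mem_sdiff, hlt, hlt, mem_ofPred_eq, not_le, le_antisymm_iff, Nat.succ_eq_add_one,
    Nat.cast_add_one, ENat.add_one_le_iff (ENat.natCast_ne_top m)]

variable [MeasurableSpace Ω] {P : Measure Ω} {p : PMF ℕ} {τ : Ω → Set Node}

lemma IsGW.measurableSet_restrictEvent (hτ : IsGW P p τ) (h : ℕ) (t : Set Node) :
    MeasurableSet (restrictEvent τ h t) :=
  hτ.2.1 (MeasurableSpace.measurableSet_generateFrom ⟨h, t, rfl⟩)

lemma IsGW.restrictEvent_zero (hτ : IsGW P p τ) : restrictEvent τ 0 {[]} = univ :=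
  eq_univ_of_forall fun ω => restrict_zero (hτ.1 ω)

lemma cylProb_zero (p : PMF ℕ) (t : Set Node) : cylProb p 0 t = 1 := by simp [cylProb]

lemma IsGW.measure_restrictEvent [IsProbabilityMeasure P] (hτ : IsGW P p τ) {h : ℕ}
    {t : Set Node} (ht : IsTree t) (hh : ∀ u ∈ t, u.length ≤ h) :
    P (restrictEvent τ h t) = cylProb p h t := by
  rcases Nat.eq_zero_or_pos h with rfl | hpos
  · have : t = {[]} := by
      rw [← restrict_zero ht]
      ext u
      exact ⟨fun hu => ⟨hu, hh u hu⟩, And.left⟩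
    rw [this, hτ.restrictEvent_zero, measure_univ, cylProb_zero]
  · exact hτ.2.2 h hpos t ht (height_le_iff.2 hh)

lemma IsGW.restrictEvent_eq_iUnion (hτ : IsGW P p τ) {h : ℕ} {t : Set Node}
    (hh : ∀ u ∈ t, u.length ≤ h) :
    restrictEvent τ h t = ⋃ c : level h t → ℕ, restrictEvent τ (h + 1) (extend h t c) := by
  ext ω
  simp only [restrictEvent, mem_ofPred_eq, mem_iUnion]
  constructor
  · rintro rfl
    exact exists_restrict_succ_eq_extend (hτ.1 ω) h
  · rintro ⟨c, hc⟩
    rw [← restrict_restrict_succ, hc, restrict_extend hh]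

lemma IsGW.restrictEvent_subset_heightLT (hτ : IsGW P p τ) {h : ℕ} {t : Set Node}
    (hl : level h t = ∅) : restrictEvent τ h t ⊆ heightLT τ h := by
  rintro ω rfl u hu
  by_contra! hlen
  rw [level_restrict] at hl
  exact hl.subset (show u.take h ∈ level h (τ ω) from
    ⟨(hτ.1 ω).2.1 u hu _ (List.take_prefix h u), by simpa using hlen⟩)

lemma IsGW.measure_restrictEvent_inter_heightLT [IsProbabilityMeasure P] (hτ : IsGW P p τ)
    (m : ℕ) {h : ℕ} {t : Set Node} (ht : IsTree t) (hh : ∀ u ∈ t, u.length ≤ h) :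
    MeasurableSet (restrictEvent τ h t ∩ heightLT τ (h + m)) ∧
      P (restrictEvent τ h t ∩ heightLT τ (h + m)) = cylProb p h t * extProb p m ^ Y h t := by
  induction m generalizing h t with
  | zero =>
    rcases (level h t).eq_empty_or_nonempty with hl | hl
    · have hY : Y h t = 0 := (congrArg Set.ncard hl).trans (ncard_empty _)
      rw [add_zero, inter_eq_left.2 (hτ.restrictEvent_subset_heightLT hl), hY, pow_zero, mul_one]
      exact ⟨hτ.measurableSet_restrictEvent h t, hτ.measure_restrictEvent ht hh⟩
    · have hY : Y h t ≠ 0 := ((ncard_pos (finite_level ht h)).2 hl).ne'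
      rw [add_zero, restrictEvent_inter_heightLT_eq_empty τ hl, show extProb p 0 = 0 from rfl,
        zero_pow hY, mul_zero, measure_empty]
      exact ⟨MeasurableSet.empty, rfl⟩
  | succ m ih =>
    let : Fintype (level h t) := (finite_level ht h).fintype
    have hY : Fintype.card (level h t) = Y h t := by
      rw [Fintype.card_eq_nat_card]; rfl
    have hstep := fun c : level h t → ℕ =>
      ih (ht.extend hh c) (length_le_of_mem_extend hh c)
    rw [hτ.restrictEvent_eq_iUnion hh, iUnion_inter, ← add_assoc, add_right_comm]
    refine ⟨MeasurableSet.iUnion fun c => (hstep c).1, ?_⟩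
    rw [measure_iUnion (fun c c' hcc => (pairwise_disjoint_restrictEvent_extend τ hh hcc).mono
      inter_subset_left inter_subset_left) fun c => (hstep c).1]
    simp only [fun c => (hstep c).2, cylProb_extend p ht hh, Y_extend ht hh, mul_assoc,
      ENNReal.tsum_mul_left, ← Finset.prod_pow_eq_pow_sum, ← Finset.prod_mul_distrib]
    rw [tsum_prod_eq_pow fun k => p k * extProb p m ^ k, hY]
    rfl

lemma IsGW.measurableSet_heightLT_and_measure_heightLT [IsProbabilityMeasure P]
    (hτ : IsGW P p τ) (m : ℕ) :
    MeasurableSet (heightLT τ m) ∧ P (heightLT τ m) = extProb p m := by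
  have h := hτ.measure_restrictEvent_inter_heightLT m (h := 0) isTree_singleton_nil (by simp)
  have hY : Y 0 {[]} = 1 := by
    rw [Y, show {u ∈ ({[]} : Set Node) | u.length = 0} = {[]} by ext u; simp, ncard_singleton]
  rwa [hτ.restrictEvent_zero, univ_inter, zero_add, cylProb_zero, one_mul, hY, pow_one] at h

lemma IsGW.measure_height_eq [IsProbabilityMeasure P] (hτ : IsGW P p τ) {n : ℕ} (hn : n ≠ 0) :
    P {ω | height (τ ω) = (n : ℕ∞)} = extProb p (n + 1) - extProb p n := by
  have h := hτ.measurableSet_heightLT_and_measure_heightLT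
  rw [setOf_height_eq τ hn, measure_sdiff (heightLT_mono τ n.le_succ) (h n).1.nullMeasurableSet
    (measure_ne_top P _), (h n).2, (h (n + 1)).2]

lemma IsGW.measure_restrictEvent_inter_height_eq [IsProbabilityMeasure P] (hτ : IsGW P p τ)
    {h : ℕ} {t : Set Node} (ht : IsTree t) (hh : ∀ u ∈ t, u.length ≤ h) {m : ℕ}
    (hm : m + h ≠ 0) :
    P (restrictEvent τ h t ∩ {ω | height (τ ω) = ((m + h : ℕ) : ℕ∞)}) =
      cylProb p h t * (extProb p (m + 1) ^ Y h t - extProb p m ^ Y h t) := by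
  have hmeas := fun m => hτ.measure_restrictEvent_inter_heightLT m ht hh
  have hfin : cylProb p h t ≠ ∞ := by
    rw [← hτ.measure_restrictEvent ht hh]
    exact measure_ne_top P _
  rw [setOf_height_eq τ hm, inter_sdiff_distrib_left, add_comm m h, add_assoc,
    measure_sdiff (inter_subset_inter_right _ (heightLT_mono τ (by omega)))
      (hmeas m).1.nullMeasurableSet (measure_ne_top P _), (hmeas m).2, (hmeas (m + 1)).2,
    ENNReal.mul_sub fun _ _ => hfin]

end GW

/-- **Corollary (local convergence under conditioning on the height).**
Let `τ` be a critical or subcritical GW tree with offspring distribution `p`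
(`0 < μ ≤ 1`). Then `τ` conditioned on `{H(τ) = n}` converges locally in distribution,
as `n → ∞`, to Kesten's immortal tree `τ*`. -/
theorem gw_height_probability_local_convergence
    {Ω : Type*} [MeasurableSpace Ω] (P : Measure Ω) [IsProbabilityMeasure P]
    (p : PMF ℕ) (hp1 : p 1 < 1) (hμpos : 0 < mean p) (hμle : mean p ≤ 1)
    (τ : Ω → Set Node) (hGW : IsGW P p τ) :
    ∀ h : ℕ, 1 ≤ h → ∀ t : Set Node, IsTree t → height t ≤ (h : ℕ∞) →
      Tendsto
        (fun n : ℕ =>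
          P ({ω | restrict h (τ ω) = t} ∩ {ω | height (τ ω) = (n : ℕ∞)}) /
            P {ω | height (τ ω) = (n : ℕ∞)})
        atTop (𝓝 (kesten p h t)) := by
  intro h hpos t ht hheight
  have hh := height_le_iff.1 hheight
  have hfin : cylProb p h t ≠ ∞ := by
    rw [← hGW.measure_restrictEvent ht hh]
    exact measure_ne_top P _
  rw [← tendsto_add_atTop_iff_nat h]
  have hlim := ENNReal.Tendsto.const_mul
    (tendsto_extProb_pow_diff_div p hp1 hμpos hμle h (Y h t)) (Or.inr hfin)
  rw [mul_comm (cylProb p h t)] at hlim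
  refine hlim.congr fun m => ?_
  have hm : m + h ≠ 0 := by omega
  rw [hGW.measure_height_eq hm, ← mul_div_assoc,
    ← hGW.measure_restrictEvent_inter_height_eq ht hh hm]
  rfl

end GWLocal
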